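/- Let p(y,z1,z2|x) be a discrete memoryless two-level security wiretap channel satisfying the Markov chain X → Z1 → Z2. If a nonnegative pair (R1,R2) satisfies R1 ≤ I(X;Y) − I(X;Z1) and R1 + R2 ≤ I(X;Y) − I(X;Z2) for some input distribution p(x) (with (Y,Z1,Z2) the corresponding channel outputs), then (R1,R2) is an achievable rate pair of the channel. -/

import Mathlib

open scoped BigOperators
noncomputable section

/-- A probability mass function on a finite type. -/
def IsPMF {α : Type*} [Fintype α] (p : α → ℝ) : Prop :=
  (∀ a, 0 ≤ p a) ∧ ∑ a, p a = 1

/-- A discrete channel from `α` to `β`: every input determines a pmf on outputs. -/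
def IsChannel {α β : Type*} [Fintype β] (W : α → β → ℝ) : Prop :=
  ∀ a, IsPMF (W a)

/-- Mutual information (in bits) of a joint pmf on `α × β`. -/
def mutInfo {α β : Type*} [Fintype α] [Fintype β] (p : α × β → ℝ) : ℝ :=
  ∑ ab : α × β,
    p ab * Real.logb 2 (p ab / ((∑ b, p (ab.1, b)) * (∑ a, p (a, ab.2))))

variable {𝒳 𝒴 𝒵₁ 𝒵₂ : Type} [Fintype 𝒳] [Fintype 𝒴] [Fintype 𝒵₁] [Fintype 𝒵₂]

/-- The Markov chain `X → Z₁ → Z₂` for the channel `W : 𝒳 → 𝒴 × 𝒵₁ × 𝒵₂`: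
the eavesdropper output `Z₂` is degraded with respect to `Z₁`. -/
def DegradedZ1Z2 (W : 𝒳 → 𝒴 × 𝒵₁ × 𝒵₂ → ℝ) : Prop :=
  ∃ q : 𝒵₁ → 𝒵₂ → ℝ, IsChannel q ∧
    ∀ x z₁ z₂, (∑ y, W x (y, z₁, z₂)) = (∑ y, ∑ z₂', W x (y, z₁, z₂')) * q z₁ z₂

/-- Joint pmf of messages, inputs and outputs induced by a (possibly stochastic) encoder
`enc` used on the memoryless channel `W` with uniform independent messages. -/
def codeJoint {n K₁ K₂ : ℕ} (W : 𝒳 → 𝒴 × 𝒵₁ × 𝒵₂ → ℝ)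
    (enc : Fin K₁ × Fin K₂ → (Fin n → 𝒳) → ℝ)
    (m : Fin K₁ × Fin K₂) (xs : Fin n → 𝒳) (ys : Fin n → 𝒴)
    (z1s : Fin n → 𝒵₁) (z2s : Fin n → 𝒵₂) : ℝ :=
  ((K₁ : ℝ) * (K₂ : ℝ))⁻¹ * enc m xs * ∏ i, W (xs i) (ys i, z1s i, z2s i)

/-- Average probability of a decoding error at the legitimate receiver. -/
def errProb {n K₁ K₂ : ℕ} (W : 𝒳 → 𝒴 × 𝒵₁ × 𝒵₂ → ℝ)
    (enc : Fin K₁ × Fin K₂ → (Fin n → 𝒳) → ℝ)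
    (dec : (Fin n → 𝒴) → Fin K₁ × Fin K₂) : ℝ :=
  ∑ m, ∑ xs, ∑ ys, ∑ z1s, ∑ z2s,
    if dec ys ≠ m then codeJoint W enc m xs ys z1s z2s else 0

/-- The information leakage `I(M₁,M₂; Z₂ⁿ)` to the weak eavesdropper realization. -/
def leakMZ2 {n K₁ K₂ : ℕ} (W : 𝒳 → 𝒴 × 𝒵₁ × 𝒵₂ → ℝ)
    (enc : Fin K₁ × Fin K₂ → (Fin n → 𝒳) → ℝ) : ℝ :=
  mutInfo (fun q : (Fin K₁ × Fin K₂) × (Fin n → 𝒵₂) =>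
    ∑ xs, ∑ ys, ∑ z1s, codeJoint W enc q.1 xs ys z1s q.2)

/-- The information leakage `I(M₁; Z₁ⁿ)` to the strong eavesdropper realization. -/
def leakM1Z1 {n K₁ K₂ : ℕ} (W : 𝒳 → 𝒴 × 𝒵₁ × 𝒵₂ → ℝ)
    (enc : Fin K₁ × Fin K₂ → (Fin n → 𝒳) → ℝ) : ℝ :=
  mutInfo (fun q : Fin K₁ × (Fin n → 𝒵₁) =>
    ∑ m₂, ∑ xs, ∑ ys, ∑ z2s, codeJoint W enc (q.1, m₂) xs ys q.2 z2s)

/-- A rate pair `(R₁,R₂)` is achievable for the two-level security wiretap channel `W`: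
there are codes of blocklength `n` whose rates are arbitrarily close to `(R₁,R₂)`, with
vanishing error probability at the legitimate receiver, vanishing normalized leakage
`(1/n) I(M₁,M₂;Z₂ⁿ)` of both messages to the weak eavesdropper realization, and vanishing
normalized leakage `(1/n) I(M₁;Z₁ⁿ)` of the high-security message to the strong one. -/
def Achievable (W : 𝒳 → 𝒴 × 𝒵₁ × 𝒵₂ → ℝ) (R₁ R₂ : ℝ) : Prop :=
  ∀ ε > 0, ∃ n : ℕ, 0 < n ∧ ∃ K₁ K₂ : ℕ, 0 < K₁ ∧ 0 < K₂ ∧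
    (n : ℝ) * (R₁ - ε) ≤ Real.logb 2 K₁ ∧ (n : ℝ) * (R₂ - ε) ≤ Real.logb 2 K₂ ∧
    ∃ enc : Fin K₁ × Fin K₂ → (Fin n → 𝒳) → ℝ, IsChannel enc ∧
      ∃ dec : (Fin n → 𝒴) → Fin K₁ × Fin K₂,
        errProb W enc dec ≤ ε ∧
        leakMZ2 W enc ≤ (n : ℝ) * ε ∧
        leakM1Z1 W enc ≤ (n : ℝ) * ε

/-- Joint pmf of the input and the legitimate receiver output. -/
def jointXY (pX : 𝒳 → ℝ) (W : 𝒳 → 𝒴 × 𝒵₁ × 𝒵₂ → ℝ) : 𝒳 × 𝒴 → ℝ :=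
  fun q => pX q.1 * ∑ z₁, ∑ z₂, W q.1 (q.2, z₁, z₂)

/-- Joint pmf of the input and the strong eavesdropper output. -/
def jointXZ1 (pX : 𝒳 → ℝ) (W : 𝒳 → 𝒴 × 𝒵₁ × 𝒵₂ → ℝ) : 𝒳 × 𝒵₁ → ℝ :=
  fun q => pX q.1 * ∑ y, ∑ z₂, W q.1 (y, q.2, z₂)

/-- Joint pmf of the input and the weak eavesdropper output. -/
def jointXZ2 (pX : 𝒳 → ℝ) (W : 𝒳 → 𝒴 × 𝒵₁ × 𝒵₂ → ℝ) : 𝒳 × 𝒵₂ → ℝ :=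
  fun q => pX q.1 * ∑ y, ∑ z₁, W q.1 (y, z₁, q.2)

/-! ### Expectations over i.i.d. families -/

theorem tw_E0 {κ A : Type*} [Fintype κ] [DecidableEq κ] [Fintype A] (P : A → ℝ)
    (hP : ∑ a, P a = 1) : ∑ C : κ → A, ∏ k, P (C k) = 1 := by
  have h := (Finset.prod_univ_sum (fun _ : κ => (Finset.univ : Finset A)) (fun _ a => P a))
  rw [Fintype.piFinset_univ] at h
  rw [← h]; simp [hP]

theorem tw_prodform {κ A : Type*} [Fintype κ] [DecidableEq κ] [Fintype A] (P : A → ℝ)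
    (F : κ → A → ℝ) :
    ∑ C : κ → A, (∏ k, P (C k)) * ∏ k, F k (C k) = ∏ k, ∑ a, P a * F k a := by
  have h := (Finset.prod_univ_sum (fun _ : κ => (Finset.univ : Finset A))
    (fun k a => P a * F k a))
  rw [Fintype.piFinset_univ] at h
  rw [h]
  exact Finset.sum_congr rfl fun C _ => Finset.prod_mul_distrib.symm

theorem tw_E1 {κ A : Type*} [Fintype κ] [DecidableEq κ] [Fintype A] (P : A → ℝ)
    (hP : ∑ a, P a = 1) (l : κ) (f : A → ℝ) :
    ∑ C : κ → A, (∏ k, P (C k)) * f (C l) = ∑ a, P a * f a := by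
  have h := tw_prodform P (fun k a => if k = l then f a else 1)
  have h2 : ∀ C : κ → A, (∏ k, if k = l then f (C k) else 1) = f (C l) := by
    intro C; simp
  simp only [h2] at h
  rw [h, Finset.prod_eq_single l]
  · simp
  · intro k _ hk; simp [hk, hP]
  · simp

theorem tw_E2 {κ A : Type*} [Fintype κ] [DecidableEq κ] [Fintype A] (P : A → ℝ)
    (hP : ∑ a, P a = 1) (l j : κ) (hlj : j ≠ l) (f g : A → ℝ) :
    ∑ C : κ → A, (∏ k, P (C k)) * (f (C l) * g (C j))
      = (∑ a, P a * f a) * (∑ a, P a * g a) := by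
  have h := tw_prodform P (fun k a => (if k = l then f a else 1) * (if k = j then g a else 1))
  have h2 : ∀ C : κ → A, (∏ k, (if k = l then f (C k) else 1) * (if k = j then g (C k) else 1))
      = f (C l) * g (C j) := by
    intro C; rw [Finset.prod_mul_distrib]; simp
  simp only [h2] at h
  rw [h, ← Finset.mul_prod_erase _ _ (Finset.mem_univ l),
    ← Finset.mul_prod_erase _ _ (Finset.mem_erase.2 ⟨hlj, Finset.mem_univ j⟩)]
  rw [Finset.prod_eq_one]
  · simp [hlj, hlj.symm]
  · intro k hk
    simp only [Finset.mem_erase, Finset.mem_univ, and_true] at hk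
    simp [hk.1, hk.2, hP]

/-- If the output probability vanishes so does every joint probability. -/
theorem tw_zero {A B : Type*} [Fintype A] [Fintype B] {P : A → ℝ} {V : A → B → ℝ}
    (hP : IsPMF P) (hV : IsChannel V) {b : B} (hb : ∑ a, P a * V a b = 0) (a : A) :
    P a * V a b = 0 :=
  (Finset.sum_eq_zero_iff_of_nonneg
    (fun a _ => mul_nonneg (hP.1 a) ((hV a).1 b))).1 hb a (Finset.mem_univ a)

theorem tw_zero_w {κ A B : Type*} [Fintype κ] [DecidableEq κ] [Fintype A] [Fintype B]
    {P : A → ℝ} {V : A → B → ℝ}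
    (hP : IsPMF P) (hV : IsChannel V) {b : B} (hb : ∑ a, P a * V a b = 0)
    (C : κ → A) (l : κ) : (∏ k, P (C k)) * V (C l) b = 0 := by
  rw [← Finset.mul_prod_erase _ _ (Finset.mem_univ l)]
  have := tw_zero hP hV hb (C l)
  rw [mul_right_comm, this, zero_mul]

theorem tw_log_tangent {x y : ℝ} (hx : 0 < x) (hy : 0 < y) :
    Real.log x ≤ Real.log y + (x - y) / y := by
  have h := Real.log_le_sub_one_of_pos (div_pos hx hy)
  rw [Real.log_div hx.ne' hy.ne'] at h
  have : (x - y) / y = x / y - 1 := by field_simp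
  linarith

/-! ### Soft covering -/

theorem tw_cover {κ ι A B : Type*} [Fintype κ] [DecidableEq κ] [Fintype ι] [DecidableEq ι]
    [Nonempty ι] [Fintype A] [Fintype B] {P : A → ℝ} {V : A → B → ℝ}
    (hP : IsPMF P) (hV : IsChannel V) (Q : B → ℝ) (hQ : ∀ b, Q b = ∑ a, P a * V a b)
    (e : ι → κ) (he : Function.Injective e) (L : ℝ) (hL : L = Fintype.card ι) :
    ∑ C : κ → A, (∏ k, P (C k)) * ∑ b, (L⁻¹ * ∑ l, V (C (e l)) b) *
        Real.log ((L⁻¹ * ∑ l, V (C (e l)) b) / Q b)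
      ≤ ∑ a, ∑ b, P a * V a b * Real.log (1 + V a b / (L * Q b)) := by
  have hLpos : 0 < L := by rw [hL]; exact_mod_cast Fintype.card_pos
  have hQ0 : ∀ b, 0 ≤ Q b := fun b => by
    rw [hQ]; exact Finset.sum_nonneg fun a _ => mul_nonneg (hP.1 a) ((hV a).1 b)
  have hw : ∀ C : κ → A, 0 ≤ ∏ k, P (C k) := fun C => Finset.prod_nonneg fun k _ => hP.1 _
  -- the key estimate for a fixed output and codeword index
  have key : ∀ (b : B) (l : ι),
      ∑ C : κ → A, (∏ k, P (C k)) * (V (C (e l)) b *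
        Real.log ((L⁻¹ * ∑ l, V (C (e l)) b) / Q b))
      ≤ ∑ a, P a * (V a b * Real.log (1 + V a b / (L * Q b))) := by
    intro b l
    set f : A → ℝ := fun a => V a b / (1 + V a b / (L * Q b)) with hf
    have hf0 : ∀ a, 0 ≤ f a := fun a => by
      have := (hV a).1 b
      have := hQ0 b
      simp only [hf]; positivity
    have step : ∀ C : κ → A, (∏ k, P (C k)) * (V (C (e l)) b *
        Real.log ((L⁻¹ * ∑ l, V (C (e l)) b) / Q b)) ≤
        (∏ k, P (C k)) * (V (C (e l)) b * Real.log (1 + V (C (e l)) b / (L * Q b)))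
        + ((∑ j ∈ Finset.univ.erase l, (∏ k, P (C k)) * (f (C (e l)) * V (C (e j)) b))
            * (L * Q b)⁻¹ - (∏ k, P (C k)) * f (C (e l))) := by
      intro C
      rcases (hQ0 b).eq_or_lt with h0 | hpos
      · have hz := fun l => tw_zero_w hP hV ((hQ b).symm.trans h0.symm) C l
        rw [← h0]
        have hz' := hz (e l)
        simp [hf, ← h0, hz']
      · have hvl := (hV (C (e l))).1 b
        rcases hvl.eq_or_lt with h0 | hvpos
        · simp [hf, ← h0]
        · have hsum : ∑ l, V (C (e l)) b = V (C (e l)) b +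
              ∑ j ∈ Finset.univ.erase l, V (C (e j)) b :=
            (Finset.add_sum_erase _ _ (Finset.mem_univ l)).symm
          set T := ∑ j ∈ Finset.univ.erase l, V (C (e j)) b with hT
          have hT0 : 0 ≤ T := Finset.sum_nonneg fun j _ => (hV _).1 b
          rw [hsum]
          set v := V (C (e l)) b with hv
          have hLQ : 0 < L * Q b := mul_pos hLpos hpos
          have e1 : L⁻¹ * (v + T) / Q b = v / (L * Q b) + T / (L * Q b) := by
            field_simp
          have htan := tw_log_tangent (x := v / (L * Q b) + T / (L * Q b))
            (y := 1 + v / (L * Q b)) (by positivity) (by positivity)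
          have e2 : (∑ j ∈ Finset.univ.erase l, (∏ k, P (C k)) * (f (C (e l)) * V (C (e j)) b))
            = (∏ k, P (C k)) * (f (C (e l)) * T) := by
            rw [hT, Finset.mul_sum, Finset.mul_sum]
          rw [e1, e2]
          have e3 : f (C (e l)) = v / (1 + v / (L * Q b)) := rfl
          rw [e3]
          have := mul_le_mul_of_nonneg_left (mul_le_mul_of_nonneg_left htan hvl) (hw C)
          refine this.trans (le_of_eq ?_)
          have : (1 + v / (L * Q b)) ≠ 0 := by positivity
          have hd : (v / (L * Q b) + T / (L * Q b) - (1 + v / (L * Q b))) 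
            = T * (L * Q b)⁻¹ - 1 := by rw [div_eq_mul_inv T]; ring
          rw [hd]
          ring
    refine (Finset.sum_le_sum fun C _ => step C).trans ?_
    rw [Finset.sum_add_distrib, Finset.sum_sub_distrib, ← Finset.sum_mul, Finset.sum_comm,
      tw_E1 P hP.2 (e l) (fun a => V a b * Real.log (1 + V a b / (L * Q b))),
      tw_E1 P hP.2 (e l) f]
    have : ∀ j ∈ Finset.univ.erase l, ∑ C : κ → A, (∏ k, P (C k)) * (f (C (e l)) * V (C (e j)) b)
        = (∑ a, P a * f a) * Q b := by
      intro j hj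
      rw [tw_E2 P hP.2 (e l) (e j) (fun h => (Finset.mem_erase.1 hj).1 (he h)) f (fun a => V a b),
        hQ]
    rw [Finset.sum_congr rfl this, Finset.sum_const, nsmul_eq_mul,
      Finset.card_erase_of_mem (Finset.mem_univ l), Finset.card_univ,
      Nat.cast_sub Fintype.card_pos, ← hL]
    have hPf : 0 ≤ ∑ a, P a * f a := Finset.sum_nonneg fun a _ => mul_nonneg (hP.1 a) (hf0 a)
    have : (L - (1 : ℕ)) * ((∑ a, P a * f a) * Q b) * (L * Q b)⁻¹ ≤ ∑ a, P a * f a := by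
      rcases (hQ0 b).eq_or_lt with h0 | hpos
      · rw [← h0]; simpa using hPf
      · rw [← div_eq_mul_inv, div_le_iff₀ (mul_pos hLpos hpos)]
        have := mul_nonneg hPf hpos.le
        push_cast
        nlinarith
    linarith
  have hrew : ∀ C : κ → A, (∏ k, P (C k)) * ∑ b, (L⁻¹ * ∑ l, V (C (e l)) b) *
        Real.log ((L⁻¹ * ∑ l, V (C (e l)) b) / Q b)
      = ∑ b, ∑ l, L⁻¹ * ((∏ k, P (C k)) * (V (C (e l)) b *
        Real.log ((L⁻¹ * ∑ l, V (C (e l)) b) / Q b))) := by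
    intro C
    rw [Finset.mul_sum]
    refine Finset.sum_congr rfl fun b _ => ?_
    rw [← Finset.mul_sum, ← Finset.mul_sum, ← Finset.sum_mul]
    ring
  simp_rw [hrew]
  rw [Finset.sum_comm]
  have hR : ∑ a, ∑ b, P a * V a b * Real.log (1 + V a b / (L * Q b))
     = ∑ b, ∑ l : ι, L⁻¹ * ∑ a, P a * (V a b * Real.log (1 + V a b / (L * Q b))) := by
    rw [Finset.sum_comm]
    refine Finset.sum_congr rfl fun b _ => ?_
    rw [Finset.sum_const, nsmul_eq_mul, Finset.card_univ, ← hL, ← mul_assoc,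
      mul_inv_cancel₀ hLpos.ne', one_mul]
    exact Finset.sum_congr rfl fun a _ => by ring
  rw [hR]
  refine Finset.sum_le_sum fun b _ => ?_
  rw [Finset.sum_comm]
  refine Finset.sum_le_sum fun l _ => ?_
  rw [← Finset.mul_sum]
  exact mul_le_mul_of_nonneg_left (key b l) (by positivity)

/-! ### Maximum likelihood decoding -/

theorem tw_decode {κ A B : Type*} [Fintype κ] [DecidableEq κ] [Nonempty κ]
    [Fintype A] [Fintype B] {P : A → ℝ} {V : A → B → ℝ}
    (hP : IsPMF P) (hV : IsChannel V) (Q : B → ℝ) (hQ : ∀ b, Q b = ∑ a, P a * V a b)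
    (N : ℝ) (hN : N = Fintype.card κ) (γ : ℝ) (hγ : 0 < γ)
    (D : (κ → A) → B → κ) (hD : ∀ (C : κ → A) (b : B) (k : κ), V (C k) b ≤ V (C (D C b)) b) :
    ∑ C : κ → A, (∏ k, P (C k)) * (N⁻¹ * ∑ k, ∑ b, if D C b ≠ k then V (C k) b else 0)
      ≤ (∑ a, ∑ b, if V a b ≤ γ * Q b then P a * V a b else 0) + (N - 1) / γ := by
  have hNpos : 0 < N := by rw [hN]; exact_mod_cast Fintype.card_pos
  have hQ0 : ∀ b, 0 ≤ Q b := fun b => by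
    rw [hQ]; exact Finset.sum_nonneg fun a _ => mul_nonneg (hP.1 a) ((hV a).1 b)
  have hQ1 : ∑ b, Q b = 1 := by
    simp_rw [hQ]; rw [Finset.sum_comm]
    simp_rw [← Finset.mul_sum, (hV _).2, mul_one, hP.2]
  have hw : ∀ C : κ → A, 0 ≤ ∏ k, P (C k) := fun C => Finset.prod_nonneg fun k _ => hP.1 _
  have hN1 : 0 ≤ N - 1 := by
    have : (1 : ℝ) ≤ Fintype.card κ := by exact_mod_cast Fintype.card_pos
    rw [hN]; linarith
  have key : ∀ (k : κ) (b : B),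
      ∑ C : κ → A, (∏ k, P (C k)) * (if D C b ≠ k then V (C k) b else 0)
      ≤ (∑ a, if V a b ≤ γ * Q b then P a * V a b else 0) + (N - 1) / γ * Q b := by
    intro k b
    have step : ∀ C : κ → A, (∏ k, P (C k)) * (if D C b ≠ k then V (C k) b else 0)
        ≤ (∏ k, P (C k)) * (if V (C k) b ≤ γ * Q b then V (C k) b else 0)
        + (∑ j ∈ Finset.univ.erase k, (∏ k, P (C k)) * (V (C k) b * V (C j) b))
            * (γ * Q b)⁻¹ := by
      intro C
      rcases (hQ0 b).eq_or_lt with h0 | hpos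
      · have hz := fun l => tw_zero_w hP hV ((hQ b).symm.trans h0.symm) C l
        rw [← h0]
        have hz' := hz k
        simp only [mul_ite, hz', mul_zero]
        simp
      · have hγQ : 0 < γ * Q b := mul_pos hγ hpos
        set T := ∑ j ∈ Finset.univ.erase k, V (C j) b with hT
        have hT0 : 0 ≤ T := Finset.sum_nonneg fun j _ => (hV _).1 b
        have e2 : (∑ j ∈ Finset.univ.erase k, (∏ k, P (C k)) * (V (C k) b * V (C j) b))
            = (∏ k, P (C k)) * (V (C k) b * T) := by
            rw [hT, Finset.mul_sum, Finset.mul_sum]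
        rw [e2, mul_assoc, ← mul_add]
        refine mul_le_mul_of_nonneg_left ?_ (hw C)
        have hv := (hV (C k)).1 b
        have hpos2 : 0 ≤ V (C k) b * T * (γ * Q b)⁻¹ := by positivity
        split_ifs with h1 h2 h2
        · linarith
        · rw [zero_add]
          have hle : V (C k) b ≤ T := (hD C b k).trans
            (Finset.single_le_sum (f := fun j => V (C j) b) (fun j _ => (hV _).1 b)
              (Finset.mem_erase.2 ⟨h1, Finset.mem_univ _⟩))
          rw [← div_eq_mul_inv, le_div_iff₀ hγQ]
          push Not at h2
          nlinarith
        · linarith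
        · linarith
    refine (Finset.sum_le_sum fun C _ => step C).trans ?_
    rw [Finset.sum_add_distrib, ← Finset.sum_mul, Finset.sum_comm,
      tw_E1 P hP.2 k (fun a => if V a b ≤ γ * Q b then V a b else 0)]
    have : ∀ j ∈ Finset.univ.erase k, ∑ C : κ → A, (∏ k, P (C k)) * (V (C k) b * V (C j) b)
        = Q b * Q b := by
      intro j hj
      rw [tw_E2 P hP.2 k j (Finset.mem_erase.1 hj).1 (fun a => V a b) (fun a => V a b), hQ]
    rw [Finset.sum_congr rfl this, Finset.sum_const, nsmul_eq_mul,
      Finset.card_erase_of_mem (Finset.mem_univ k), Finset.card_univ,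
      Nat.cast_sub Fintype.card_pos, ← hN]
    refine add_le_add (le_of_eq (Finset.sum_congr rfl fun a _ => by split_ifs <;> simp))
      (le_of_eq ?_)
    rcases (hQ0 b).eq_or_lt with h0 | hpos
    · rw [← h0]; simp
    · push_cast; field_simp
  have hrew : ∀ C : κ → A, (∏ k, P (C k)) *
      (N⁻¹ * ∑ k, ∑ b, if D C b ≠ k then V (C k) b else 0)
      = ∑ k, ∑ b, N⁻¹ * ((∏ k, P (C k)) * (if D C b ≠ k then V (C k) b else 0)) := by
    intro C
    simp_rw [← Finset.mul_sum]
    ring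
  simp_rw [hrew]
  rw [Finset.sum_comm]
  calc _ ≤ ∑ k : κ, N⁻¹ * ∑ b, ((∑ a, if V a b ≤ γ * Q b then P a * V a b else 0)
        + (N - 1) / γ * Q b) := by
        refine Finset.sum_le_sum fun k _ => ?_
        rw [Finset.sum_comm, Finset.mul_sum]
        refine Finset.sum_le_sum fun b _ => ?_
        rw [← Finset.mul_sum]
        exact mul_le_mul_of_nonneg_left (key k b) (by positivity)
    _ = _ := by
        rw [Finset.sum_const, nsmul_eq_mul, Finset.card_univ, ← hN, ← mul_assoc,
          mul_inv_cancel₀ hNpos.ne', one_mul, Finset.sum_add_distrib, ← Finset.mul_sum, hQ1,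
          mul_one, Finset.sum_comm]

/-! ### Divergence inequalities -/

theorem tw_kl_pt {u q : ℝ} (hu : 0 ≤ u) (hq : 0 ≤ q) (h : q = 0 → u = 0) :
    u - q ≤ u * Real.log (u / q) := by
  rcases hu.eq_or_lt with h0 | hu'
  · rw [← h0]; simpa using hq
  · have hq' : 0 < q := lt_of_le_of_ne hq (fun e => hu'.ne' (h e.symm))
    have := Real.one_sub_inv_le_log_of_pos (div_pos hu' hq')
    have h2 := mul_le_mul_of_nonneg_left this hu
    refine le_trans (le_of_eq ?_) h2
    field_simp

theorem tw_kl_nonneg {B : Type*} [Fintype B] {U Q : B → ℝ} (hU : IsPMF U) (hQ : IsPMF Q)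
    (h : ∀ b, Q b = 0 → U b = 0) : 0 ≤ ∑ b, U b * Real.log (U b / Q b) := by
  have : ∑ b, (U b - Q b) ≤ ∑ b, U b * Real.log (U b / Q b) :=
    Finset.sum_le_sum fun b _ => tw_kl_pt (hU.1 b) (hQ.1 b) (h b)
  rw [Finset.sum_sub_distrib, hU.2, hQ.2] at this
  linarith

/-- Natural-log form of the mutual information of an input pmf and a channel. -/
def twJ {A B : Type*} [Fintype A] [Fintype B] (P : A → ℝ) (V : A → B → ℝ) : ℝ :=
  ∑ a, ∑ b, P a * V a b * Real.log (V a b / ∑ a', P a' * V a' b)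

theorem tw_mutInfo {A B : Type*} [Fintype A] [Fintype B] {P : A → ℝ} {V : A → B → ℝ}
    (hV : IsChannel V) (p : A × B → ℝ) (hp : ∀ q, p q = P q.1 * V q.1 q.2) :
    mutInfo p * Real.log 2 = twJ P V := by
  have h2 : Real.log 2 ≠ 0 := (Real.log_pos one_lt_two).ne'
  unfold mutInfo twJ
  rw [Finset.sum_mul, Fintype.sum_prod_type]
  refine Finset.sum_congr rfl fun a _ => Finset.sum_congr rfl fun b _ => ?_
  simp only [hp, ← Finset.mul_sum, (hV a).2, mul_one]
  rw [Real.logb, mul_div_assoc', div_mul_cancel₀ _ h2]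
  by_cases ha : P a = 0
  · simp [ha]
  · rw [mul_div_mul_left _ _ ha]

theorem tw_out_pmf {A B : Type*} [Fintype A] [Fintype B] {P : A → ℝ} {V : A → B → ℝ}
    (hP : IsPMF P) (hV : IsChannel V) : IsPMF (fun b => ∑ a, P a * V a b) := by
  refine ⟨fun b => Finset.sum_nonneg fun a _ => mul_nonneg (hP.1 a) ((hV a).1 b), ?_⟩
  rw [Finset.sum_comm]
  simp_rw [← Finset.mul_sum, (hV _).2, mul_one, hP.2]

theorem tw_J_nonneg {A B : Type*} [Fintype A] [Fintype B] {P : A → ℝ} {V : A → B → ℝ}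
    (hP : IsPMF P) (hV : IsChannel V) : 0 ≤ twJ P V := by
  have hQ := tw_out_pmf hP hV
  have : ∑ a, ∑ b, P a * (V a b - ∑ a', P a' * V a' b) ≤ twJ P V := by
    refine Finset.sum_le_sum fun a _ => Finset.sum_le_sum fun b _ => ?_
    rcases (hP.1 a).eq_or_lt with h0 | hpos
    · simp [← h0]
    · rw [mul_assoc]
      refine mul_le_mul_of_nonneg_left (tw_kl_pt ((hV a).1 b) (hQ.1 b) fun h => ?_) hpos.le
      exact (mul_eq_zero.1 (tw_zero hP hV h a)).resolve_left hpos.ne'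
  refine le_trans (le_of_eq ?_) this
  simp_rw [← Finset.mul_sum, Finset.sum_sub_distrib, (hV _).2, hQ.2]
  simp

/-- Leakage is bounded by the average divergence to any reference output law. -/
theorem tw_leak {M B : Type*} [Fintype M] [Nonempty M] [Fintype B] {U : M → B → ℝ} {Q : B → ℝ}
    (hU : IsChannel U) (hQ : IsPMF Q) (hac : ∀ m b, Q b = 0 → U m b = 0)
    (p : M × B → ℝ) (c : ℝ) (hc : c = Fintype.card M) (hp : ∀ q, p q = c⁻¹ * U q.1 q.2) :
    mutInfo p * Real.log 2 ≤ c⁻¹ * ∑ m, ∑ b, U m b * Real.log (U m b / Q b) := by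
  have hcpos : 0 < c := by rw [hc]; exact_mod_cast Fintype.card_pos
  have hPm : IsPMF (fun _ : M => c⁻¹) := by
    refine ⟨fun _ => by positivity, ?_⟩
    rw [Finset.sum_const, nsmul_eq_mul, Finset.card_univ, ← hc, mul_inv_cancel₀ hcpos.ne']
  rw [tw_mutInfo (P := fun _ => c⁻¹) hU p hp]
  have hO := tw_out_pmf hPm hU
  unfold twJ
  set O : B → ℝ := fun b => ∑ a, c⁻¹ * U a b with hOdef
  have hUO : ∀ m b, O b = 0 → U m b = 0 := fun m b h => by
    exact (mul_eq_zero.1 (tw_zero hPm hU h m)).resolve_left (by positivity)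
  have hOQ : ∀ b, Q b = 0 → O b = 0 := fun b h => by
    simp only [hOdef]; exact Finset.sum_eq_zero fun m _ => by rw [hac m b h, mul_zero]
  have hkl := tw_kl_nonneg hO hQ hOQ
  have : c⁻¹ * ∑ m, ∑ b, U m b * Real.log (U m b / Q b)
      = (∑ m, ∑ b, c⁻¹ * U m b * Real.log (U m b / O b)) + ∑ b, O b * Real.log (O b / Q b) := by
    have e : ∑ b, O b * Real.log (O b / Q b)
        = ∑ m, ∑ b, c⁻¹ * U m b * Real.log (O b / Q b) := by
      rw [Finset.sum_comm]
      refine Finset.sum_congr rfl fun b _ => ?_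
      rw [← Finset.sum_mul]
    rw [e, ← Finset.sum_add_distrib, Finset.mul_sum]
    refine Finset.sum_congr rfl fun m _ => ?_
    rw [← Finset.sum_add_distrib, Finset.mul_sum]
    refine Finset.sum_congr rfl fun b _ => ?_
    by_cases h : U m b = 0
    · simp [h]
    · have h1 : O b ≠ 0 := fun h' => h (hUO m b h')
      have h2 : Q b ≠ 0 := fun h' => h (hac m b h')
      rw [Real.log_div h h2, Real.log_div h h1, Real.log_div h1 h2]
      ring
  rw [this]
  linarith

/-! ### Block channels -/

/-- n-fold product of a pmf. -/
def twPn {A : Type*} (n : ℕ) (P : A → ℝ) : (Fin n → A) → ℝ := fun a => ∏ i, P (a i)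

/-- n-fold product of a channel. -/
def twVn {A B : Type*} (n : ℕ) (V : A → B → ℝ) : (Fin n → A) → (Fin n → B) → ℝ :=
  fun a b => ∏ i, V (a i) (b i)

theorem tw_sumprod {B : Type*} [Fintype B] {n : ℕ} (f : Fin n → B → ℝ) :
    ∑ b : Fin n → B, ∏ i, f i (b i) = ∏ i, ∑ b, f i b := by
  have h := (Finset.prod_univ_sum (fun _ : Fin n => (Finset.univ : Finset B)) f)
  rw [Fintype.piFinset_univ] at h
  exact h.symm

theorem twPn_pmf {A : Type*} [Fintype A] (n : ℕ) {P : A → ℝ} (hP : IsPMF P) :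
    IsPMF (twPn n P) :=
  ⟨fun a => Finset.prod_nonneg fun i _ => hP.1 _, tw_E0 P hP.2⟩

theorem twVn_channel {A B : Type*} [Fintype B] (n : ℕ) {V : A → B → ℝ} (hV : IsChannel V) :
    IsChannel (twVn n V) := fun a =>
  ⟨fun b => Finset.prod_nonneg fun i _ => (hV _).1 _, by
    unfold twVn
    rw [tw_sumprod (fun i b => V (a i) b)]
    simp [(hV _).2]⟩

theorem twQn {A B : Type*} [Fintype A] [Fintype B] (n : ℕ) (P : A → ℝ) (V : A → B → ℝ)
    (b : Fin n → B) :
    ∏ i, (∑ a, P a * V a (b i)) = ∑ a, twPn n P a * twVn n V a b := by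
  unfold twPn twVn
  rw [← tw_sumprod (fun i a => P a * V a (b i))]
  exact Finset.sum_congr rfl fun a _ => Finset.prod_mul_distrib

/-- Second moment of an i.i.d. centred sum. -/
theorem tw_second {S : Type*} [Fintype S] (n : ℕ) (r g : S → ℝ) (hr : ∑ s, r s = 1)
    (hg : ∑ s, r s * g s = 0) :
    ∑ s : Fin n → S, (∏ i, r (s i)) * (∑ i, g (s i)) ^ 2 = n * ∑ s, r s * g s ^ 2 := by
  have : ∀ s : Fin n → S, (∏ i, r (s i)) * (∑ i, g (s i)) ^ 2
      = ∑ i, ∑ j, (∏ i, r (s i)) * (g (s i) * g (s j)) := by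
    intro s
    rw [sq, Finset.sum_mul_sum, Finset.mul_sum]
    exact Finset.sum_congr rfl fun i _ => by rw [Finset.mul_sum]
  simp_rw [this]
  rw [Finset.sum_comm]
  have h2 : ∀ i : Fin n, ∑ s : Fin n → S, ∑ j, (∏ i, r (s i)) * (g (s i) * g (s j))
      = ∑ s, r s * g s ^ 2 := by
    intro i
    rw [Finset.sum_comm, Finset.sum_eq_single i]
    · rw [tw_E1 r hr i (fun s => g s * g s)]
      simp_rw [sq]
    · intro j _ hj
      rw [tw_E2 r hr i j hj g g, hg, zero_mul]
    · simp
  simp_rw [h2]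
  simp

/-- Information density centred at its mean (natural log). -/
def twg {A B : Type*} [Fintype A] [Fintype B] (P : A → ℝ) (V : A → B → ℝ) (s : A × B) : ℝ :=
  Real.log (V s.1 s.2 / ∑ a', P a' * V a' s.2) - twJ P V

/-- Variance of the information density. -/
def twσ {A B : Type*} [Fintype A] [Fintype B] (P : A → ℝ) (V : A → B → ℝ) : ℝ :=
  ∑ s : A × B, P s.1 * V s.1 s.2 * twg P V s ^ 2

theorem tw_joint_one {A B : Type*} [Fintype A] [Fintype B] {P : A → ℝ} {V : A → B → ℝ}
    (hP : IsPMF P) (hV : IsChannel V) : ∑ a, ∑ b, P a * V a b = 1 := by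
  simp_rw [← Finset.mul_sum, (hV _).2, mul_one, hP.2]

theorem tw_second_n {A B : Type*} [Fintype A] [Fintype B] (n : ℕ) {P : A → ℝ} {V : A → B → ℝ}
    (hP : IsPMF P) (hV : IsChannel V) :
    ∑ a, ∑ b, twPn n P a * twVn n V a b * (∑ i, twg P V (a i, b i)) ^ 2 = n * twσ P V := by
  have h := tw_second n (fun s : A × B => P s.1 * V s.1 s.2) (twg P V)
    (by rw [Fintype.sum_prod_type]; exact tw_joint_one hP hV)
    (by
      simp only [twg, mul_sub, Finset.sum_sub_distrib]
      rw [← Finset.sum_mul, Fintype.sum_prod_type, Fintype.sum_prod_type]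
      simp only [tw_joint_one hP hV]
      simp [twJ])
  unfold twσ
  rw [← h, ← Fintype.sum_prod_type', ← (Equiv.arrowProdEquivProdArrow (Fin n) (fun _ => A) (fun _ => B)).sum_comp]
  refine Finset.sum_congr rfl fun s _ => ?_
  simp only [twPn, twVn, Equiv.arrowProdEquivProdArrow, Equiv.coe_fn_mk, Finset.prod_mul_distrib]

theorem tw_density {A B : Type*} [Fintype A] [Fintype B] (n : ℕ) {P : A → ℝ} {V : A → B → ℝ}
    (hP : IsPMF P) (hV : IsChannel V) (a : Fin n → A) (b : Fin n → B)
    (h : twPn n P a * twVn n V a b ≠ 0) :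
    0 < twVn n V a b ∧ 0 < (∏ i, (∑ a, P a * V a (b i))) ∧
    twVn n V a b = Real.exp (n * twJ P V + ∑ i, twg P V (a i, b i)) *
      ∏ i, (∑ a, P a * V a (b i)) := by
  unfold twPn twVn at *
  rw [← Finset.prod_mul_distrib] at h
  have hne : ∀ i, P (a i) * V (a i) (b i) ≠ 0 := fun i =>
    Finset.prod_ne_zero_iff.1 h i (Finset.mem_univ i)
  have hv : ∀ i, 0 < V (a i) (b i) := fun i =>
    lt_of_le_of_ne ((hV _).1 _) (right_ne_zero_of_mul (hne i)).symm
  have hq : ∀ i, 0 < ∑ a, P a * V a (b i) := fun i =>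
    lt_of_le_of_ne ((tw_out_pmf hP hV).1 _) (fun e => hne i (tw_zero hP hV e.symm _))
  refine ⟨Finset.prod_pos fun i _ => hv i, Finset.prod_pos fun i _ => hq i, ?_⟩
  have : (n : ℝ) * twJ P V + ∑ i, twg P V (a i, b i)
      = ∑ i, Real.log (V (a i) (b i) / ∑ a, P a * V a (b i)) := by
    simp [twg, Finset.sum_sub_distrib]
  rw [this, Real.exp_sum, ← Finset.prod_mul_distrib]
  refine Finset.prod_congr rfl fun i _ => ?_
  rw [Real.exp_log (div_pos (hv i) (hq i)), div_mul_cancel₀ _ (hq i).ne']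

/-- Bound on the soft covering functional. -/
theorem tw_cover_n {A B : Type*} [Fintype A] [Fintype B] (n : ℕ) (hn : 0 < n) {P : A → ℝ}
    {V : A → B → ℝ} (hP : IsPMF P) (hV : IsChannel V) (L : ℝ) (hL : 0 < L) (δ c : ℝ) (hδ : 0 < δ)
    (hc0 : 0 ≤ c) (hc : n * twJ P V - Real.log L ≤ c) :
    ∑ a, ∑ b, twPn n P a * twVn n V a b *
      Real.log (1 + twVn n V a b / (L * ∏ i, (∑ a, P a * V a (b i))))
      ≤ 1 + n * δ + c + twσ P V / δ := by
  have hn' : (0 : ℝ) < n := by exact_mod_cast hn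
  have hP' := twPn_pmf n hP
  have hV' := twVn_channel n hV
  have step : ∀ a b, twPn n P a * twVn n V a b *
      Real.log (1 + twVn n V a b / (L * ∏ i, (∑ a, P a * V a (b i))))
      ≤ (1 + n * δ + c) * (twPn n P a * twVn n V a b) +
        (n * δ)⁻¹ * (twPn n P a * twVn n V a b * (∑ i, twg P V (a i, b i)) ^ 2) := by
    intro a b
    by_cases h : twPn n P a * twVn n V a b = 0
    · simp [h]
    obtain ⟨h1, h2, h3⟩ := tw_density n hP hV a b h
    have hpos : 0 ≤ twPn n P a * twVn n V a b := mul_nonneg (hP'.1 a) ((hV' a).1 b)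
    have hr : twVn n V a b / (L * ∏ i, (∑ a, P a * V a (b i)))
        = Real.exp (n * twJ P V + ∑ i, twg P V (a i, b i) - Real.log L) := by
      rw [Real.exp_sub, Real.exp_log hL, h3]
      field_simp
    rw [hr]
    set t := ∑ i, twg P V (a i, b i) with ht
    have hbound : Real.log (1 + Real.exp (n * twJ P V + t - Real.log L))
        ≤ 1 + n * δ + c + (n * δ)⁻¹ * t ^ 2 := by
      have habs : t ≤ n * δ + (n * δ)⁻¹ * t ^ 2 := by
        have hx : 0 < n * δ := by positivity
        have : n * δ + (n * δ)⁻¹ * t ^ 2 - t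
          = (n * δ)⁻¹ * ((t - n * δ / 2) ^ 2 + 3 / 4 * (n * δ) ^ 2) := by
          field_simp; ring
        have h4 : 0 ≤ (n * δ)⁻¹ * ((t - n * δ / 2) ^ 2 + 3 / 4 * (n * δ) ^ 2) := by positivity
        linarith
      set s := n * δ + c + (n * δ)⁻¹ * t ^ 2 with hs
      have hs0 : 0 ≤ s := by positivity
      have hle : n * twJ P V + t - Real.log L ≤ s := by linarith
      rw [Real.log_le_iff_le_exp (by positivity)]
      have e1 : Real.exp (n * twJ P V + t - Real.log L) ≤ Real.exp s := Real.exp_le_exp.2 hle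
      have e2 : 1 ≤ Real.exp s := Real.one_le_exp hs0
      have e3 : (2 : ℝ) ≤ Real.exp 1 := by
        have := Real.add_one_le_exp (1 : ℝ); linarith
      have e4 : 1 + n * δ + c + (n * δ)⁻¹ * t ^ 2 = 1 + s := by rw [hs]; ring
      rw [e4, Real.exp_add]
      nlinarith
    refine (mul_le_mul_of_nonneg_left hbound hpos).trans (le_of_eq (by ring))
  refine (Finset.sum_le_sum fun a _ => Finset.sum_le_sum fun b _ => step a b).trans ?_
  simp_rw [Finset.sum_add_distrib, ← Finset.mul_sum]
  have e1 : ∑ a, twPn n P a * ∑ b, twVn n V a b = 1 := by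
    simp_rw [(hV' _).2, mul_one, hP'.2]
  rw [e1, tw_second_n n hP hV]
  refine le_of_eq ?_
  field_simp

/-- Bound on the atypicality probability. -/
theorem tw_atyp_n {A B : Type*} [Fintype A] [Fintype B] (n : ℕ) (hn : 0 < n) {P : A → ℝ}
    {V : A → B → ℝ} (hP : IsPMF P) (hV : IsChannel V) (δ : ℝ) (hδ : 0 < δ) :
    (∑ a, ∑ b, if twVn n V a b ≤ Real.exp (n * (twJ P V - δ)) * ∏ i, (∑ a, P a * V a (b i))
      then twPn n P a * twVn n V a b else 0)
      ≤ twσ P V / (n * δ ^ 2) := by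
  have hn' : (0 : ℝ) < n := by exact_mod_cast hn
  have hP' := twPn_pmf n hP
  have hV' := twVn_channel n hV
  have step : ∀ a b, (if twVn n V a b ≤ Real.exp (n * (twJ P V - δ)) *
      ∏ i, (∑ a, P a * V a (b i)) then twPn n P a * twVn n V a b else 0)
      ≤ ((n * δ) ^ 2)⁻¹ * (twPn n P a * twVn n V a b * (∑ i, twg P V (a i, b i)) ^ 2) := by
    intro a b
    by_cases h : twPn n P a * twVn n V a b = 0
    · simp [h]
    obtain ⟨h1, h2, h3⟩ := tw_density n hP hV a b h
    have hpos : 0 ≤ twPn n P a * twVn n V a b := mul_nonneg (hP'.1 a) ((hV' a).1 b)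
    split_ifs with hif
    · have h4 : Real.exp (n * twJ P V + ∑ i, twg P V (a i, b i)) ≤
          Real.exp (n * (twJ P V - δ)) := by
        rw [h3] at hif
        exact le_of_mul_le_mul_right hif h2
      rw [Real.exp_le_exp] at h4
      have h5 : n * δ ≤ -(∑ i, twg P V (a i, b i)) := by linarith
      have h6 : (n * δ) ^ 2 ≤ (∑ i, twg P V (a i, b i)) ^ 2 := by
        have : 0 < n * δ := by positivity
        nlinarith
      rw [inv_mul_eq_div, le_div_iff₀ (by positivity)]
      exact mul_le_mul_of_nonneg_left h6 hpos
    · positivity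
  refine (Finset.sum_le_sum fun a _ => Finset.sum_le_sum fun b _ => step a b).trans ?_
  simp_rw [← Finset.mul_sum]
  rw [tw_second_n n hP hV]
  refine le_of_eq ?_
  field_simp

/-! ### The random code -/

/-- Marginal channel to the legitimate receiver. -/
def twVY (W : 𝒳 → 𝒴 × 𝒵₁ × 𝒵₂ → ℝ) : 𝒳 → 𝒴 → ℝ := fun x y => ∑ z₁, ∑ z₂, W x (y, z₁, z₂)
/-- Marginal channel to the strong eavesdropper. -/
def twV1 (W : 𝒳 → 𝒴 × 𝒵₁ × 𝒵₂ → ℝ) : 𝒳 → 𝒵₁ → ℝ := fun x z₁ => ∑ y, ∑ z₂, W x (y, z₁, z₂)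
/-- Marginal channel to the weak eavesdropper. -/
def twV2 (W : 𝒳 → 𝒴 × 𝒵₁ × 𝒵₂ → ℝ) : 𝒳 → 𝒵₂ → ℝ := fun x z₂ => ∑ y, ∑ z₁, W x (y, z₁, z₂)

theorem twVY_ch {W : 𝒳 → 𝒴 × 𝒵₁ × 𝒵₂ → ℝ} (hW : IsChannel W) : IsChannel (twVY W) := by
  intro x
  refine ⟨fun y => Finset.sum_nonneg fun _ _ => Finset.sum_nonneg fun _ _ => (hW x).1 _, ?_⟩
  rw [← (hW x).2, Fintype.sum_prod_type]
  exact Finset.sum_congr rfl fun y _ => by rw [Fintype.sum_prod_type]; rfl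

theorem twV1_ch {W : 𝒳 → 𝒴 × 𝒵₁ × 𝒵₂ → ℝ} (hW : IsChannel W) : IsChannel (twV1 W) := by
  intro x
  refine ⟨fun y => Finset.sum_nonneg fun _ _ => Finset.sum_nonneg fun _ _ => (hW x).1 _, ?_⟩
  rw [← (hW x).2, Fintype.sum_prod_type]
  simp only [twV1]
  rw [Finset.sum_comm]
  exact Finset.sum_congr rfl fun y _ => by rw [Fintype.sum_prod_type]

theorem twV2_ch {W : 𝒳 → 𝒴 × 𝒵₁ × 𝒵₂ → ℝ} (hW : IsChannel W) : IsChannel (twV2 W) := by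
  intro x
  refine ⟨fun y => Finset.sum_nonneg fun _ _ => Finset.sum_nonneg fun _ _ => (hW x).1 _, ?_⟩
  rw [← (hW x).2, Fintype.sum_prod_type]
  simp only [twV2]
  rw [Finset.sum_comm]
  exact Finset.sum_congr rfl fun y _ => by rw [Fintype.sum_prod_type, Finset.sum_comm]

theorem twVY_n (n : ℕ) (W : 𝒳 → 𝒴 × 𝒵₁ × 𝒵₂ → ℝ) (xs : Fin n → 𝒳) (ys : Fin n → 𝒴) :
    ∑ z1s : Fin n → 𝒵₁, ∑ z2s : Fin n → 𝒵₂, ∏ i, W (xs i) (ys i, z1s i, z2s i)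
      = twVn n (twVY W) xs ys := by
  simp_rw [fun z1s : Fin n → 𝒵₁ => tw_sumprod (fun i z₂ => W (xs i) (ys i, z1s i, z₂))]
  rw [tw_sumprod (fun i z₁ => ∑ z₂, W (xs i) (ys i, z₁, z₂))]
  rfl

theorem twV1_n (n : ℕ) (W : 𝒳 → 𝒴 × 𝒵₁ × 𝒵₂ → ℝ) (xs : Fin n → 𝒳) (z1s : Fin n → 𝒵₁) :
    ∑ ys : Fin n → 𝒴, ∑ z2s : Fin n → 𝒵₂, ∏ i, W (xs i) (ys i, z1s i, z2s i)
      = twVn n (twV1 W) xs z1s := by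
  simp_rw [fun ys : Fin n → 𝒴 => tw_sumprod (fun i z₂ => W (xs i) (ys i, z1s i, z₂))]
  rw [tw_sumprod (fun i y => ∑ z₂, W (xs i) (y, z1s i, z₂))]
  rfl

theorem twV2_n (n : ℕ) (W : 𝒳 → 𝒴 × 𝒵₁ × 𝒵₂ → ℝ) (xs : Fin n → 𝒳) (z2s : Fin n → 𝒵₂) :
    ∑ ys : Fin n → 𝒴, ∑ z1s : Fin n → 𝒵₁, ∏ i, W (xs i) (ys i, z1s i, z2s i)
      = twVn n (twV2 W) xs z2s := by
  simp_rw [fun ys : Fin n → 𝒴 => tw_sumprod (fun i z₁ => W (xs i) (ys i, z₁, z2s i))]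
  rw [tw_sumprod (fun i y => ∑ z₁, W (xs i) (y, z₁, z2s i))]
  rfl

open Classical in
/-- The stochastic encoder of a codebook. -/
def twEnc {A : Type*} {K₁ K₂ L : ℕ} (C : (Fin K₁ × Fin K₂) × Fin L → A) :
    Fin K₁ × Fin K₂ → A → ℝ :=
  fun m xs => (L : ℝ)⁻¹ * ∑ l, if xs = C (m, l) then 1 else 0

theorem twEnc_sum {A : Type*} [Fintype A] {K₁ K₂ L : ℕ} (C : (Fin K₁ × Fin K₂) × Fin L → A)
    (m : Fin K₁ × Fin K₂) (F : A → ℝ) :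
    ∑ xs, twEnc C m xs * F xs = (L : ℝ)⁻¹ * ∑ l, F (C (m, l)) := by
  classical
  unfold twEnc
  simp_rw [mul_assoc, ← Finset.mul_sum, Finset.sum_mul]
  rw [Finset.sum_comm]
  simp

theorem twEnc_ch {A : Type*} [Fintype A] {K₁ K₂ L : ℕ} (hL : 0 < L)
    (C : (Fin K₁ × Fin K₂) × Fin L → A) : IsChannel (twEnc C) := by
  classical
  intro m
  refine ⟨fun xs => ?_, ?_⟩
  · unfold twEnc
    exact mul_nonneg (by positivity) (Finset.sum_nonneg fun l _ => by split_ifs <;> norm_num)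
  · have h := twEnc_sum C m (fun _ => 1)
    simp only [mul_one] at h
    rw [h]
    have : (L : ℝ) ≠ 0 := by positivity
    simp [this]

theorem tw_avg_pmf {ι A B : Type*} [Fintype ι] [Nonempty ι] [Fintype B] {V : A → B → ℝ}
    (hV : IsChannel V) (c : ι → A) (L : ℝ) (hL : L = Fintype.card ι) :
    IsPMF (fun b => L⁻¹ * ∑ l, V (c l) b) := by
  have hLpos : 0 < L := by rw [hL]; exact_mod_cast Fintype.card_pos
  refine ⟨fun b => mul_nonneg (by positivity) (Finset.sum_nonneg fun l _ => (hV _).1 b), ?_⟩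
  rw [← Finset.mul_sum, Finset.sum_comm]
  simp_rw [(hV _).2]
  rw [Finset.sum_const, nsmul_eq_mul, Finset.card_univ, ← hL, mul_one, inv_mul_cancel₀ hLpos.ne']

theorem tw_errProb {n K₁ K₂ L : ℕ} (W : 𝒳 → 𝒴 × 𝒵₁ × 𝒵₂ → ℝ) (hW : IsChannel W)
    (C : (Fin K₁ × Fin K₂) × Fin L → (Fin n → 𝒳)) (D : (Fin n → 𝒴) → (Fin K₁ × Fin K₂) × Fin L) :
    errProb W (twEnc C) (fun ys => (D ys).1) ≤
      ((K₁ : ℝ) * K₂ * L)⁻¹ * ∑ k, ∑ b, if D b ≠ k then twVn n (twVY W) (C k) b else 0 := by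
  have hV := twVn_channel n (twVY_ch hW)
  have e : errProb W (twEnc C) (fun ys => (D ys).1) =
      ((K₁ : ℝ) * K₂ * L)⁻¹ * ∑ k : (Fin K₁ × Fin K₂) × Fin L, ∑ b,
        if (D b).1 ≠ k.1 then twVn n (twVY W) (C k) b else 0 := by
    unfold errProb codeJoint
    conv_rhs => rw [Fintype.sum_prod_type, Finset.mul_sum]
    refine Finset.sum_congr rfl fun m _ => ?_
    have h1 : ∀ (xs : Fin n → 𝒳) (ys : Fin n → 𝒴),
        (∑ z1s : Fin n → 𝒵₁, ∑ z2s : Fin n → 𝒵₂, if (D ys).1 ≠ m then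
          ((K₁ : ℝ) * (K₂ : ℝ))⁻¹ * twEnc C m xs * ∏ i, W (xs i) (ys i, z1s i, z2s i) else 0)
        = ((K₁ : ℝ) * (K₂ : ℝ))⁻¹ * (twEnc C m xs *
          (if (D ys).1 ≠ m then twVn n (twVY W) xs ys else 0)) := by
      intro xs ys
      split_ifs
      · simp_rw [← Finset.mul_sum]
        rw [twVY_n, mul_assoc]
      · simp
    simp_rw [h1, ← Finset.mul_sum]
    rw [twEnc_sum C m (fun xs => ∑ ys, if (D ys).1 ≠ m then twVn n (twVY W) xs ys else 0),
      ← mul_assoc, ← mul_inv]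
  rw [e]
  refine mul_le_mul_of_nonneg_left ?_ (by positivity)
  refine Finset.sum_le_sum fun k _ => Finset.sum_le_sum fun b _ => ?_
  have := (hV (C k)).1 b
  split_ifs with h1 h2 h2
  · exact le_rfl
  · exact absurd (by rw [not_not.1 h2]) h1
  · exact this
  · exact le_rfl

theorem tw_joint2 {n K₁ K₂ L : ℕ} (W : 𝒳 → 𝒴 × 𝒵₁ × 𝒵₂ → ℝ)
    (C : (Fin K₁ × Fin K₂) × Fin L → (Fin n → 𝒳)) (m : Fin K₁ × Fin K₂) (z2s : Fin n → 𝒵₂) :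
    ∑ xs, ∑ ys, ∑ z1s, codeJoint W (twEnc C) m xs ys z1s z2s
      = ((K₁ : ℝ) * K₂)⁻¹ * ((L : ℝ)⁻¹ * ∑ l, twVn n (twV2 W) (C (m, l)) z2s) := by
  unfold codeJoint
  simp_rw [← Finset.mul_sum, twV2_n, mul_assoc, ← Finset.mul_sum]
  rw [twEnc_sum C m (fun xs => twVn n (twV2 W) xs z2s)]

theorem tw_joint1 {n K₁ K₂ L : ℕ} (W : 𝒳 → 𝒴 × 𝒵₁ × 𝒵₂ → ℝ)
    (C : (Fin K₁ × Fin K₂) × Fin L → (Fin n → 𝒳)) (m : Fin K₁) (z1s : Fin n → 𝒵₁) :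
    ∑ m₂, ∑ xs, ∑ ys, ∑ z2s, codeJoint W (twEnc C) (m, m₂) xs ys z1s z2s
      = (K₁ : ℝ)⁻¹ * (((K₂ : ℝ) * L)⁻¹ *
        ∑ l : Fin K₂ × Fin L, twVn n (twV1 W) (C ((m, l.1), l.2)) z1s) := by
  unfold codeJoint
  simp_rw [← Finset.mul_sum, twV1_n, mul_assoc, ← Finset.mul_sum]
  simp_rw [fun m₂ => twEnc_sum C (m, m₂) (fun xs => twVn n (twV1 W) xs z1s)]
  rw [← Finset.mul_sum, Fintype.sum_prod_type, mul_inv, mul_inv]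
  ring

theorem tw_pick {Ω : Type*} [Fintype Ω] (w F : Ω → ℝ) (hw : ∀ c, 0 ≤ w c) (hw1 : ∑ c, w c = 1)
    (B : ℝ) (h : ∑ c, w c * F c ≤ B) : ∃ c, w c ≠ 0 ∧ F c ≤ B := by
  by_contra hcon
  push Not at hcon
  have h1 : ∑ c, w c * B < ∑ c, w c * F c := by
    have hex : ∃ c ∈ Finset.univ, w c ≠ 0 := by
      by_contra h0
      push Not at h0
      rw [Finset.sum_eq_zero h0] at hw1
      exact zero_ne_one hw1
    obtain ⟨c, _, hc⟩ := hex
    refine Finset.sum_lt_sum (fun c _ => ?_) ⟨c, Finset.mem_univ c, ?_⟩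
    · by_cases h0 : w c = 0
      · simp [h0]
      · exact mul_le_mul_of_nonneg_left (hcon c h0).le (hw c)
    · exact mul_lt_mul_of_pos_left (hcon c hc) (lt_of_le_of_ne (hw c) hc.symm)
  rw [← Finset.sum_mul, hw1, one_mul] at h1
  linarith

theorem tw_code {n K₁ K₂ L : ℕ} (hn : 0 < n) (hK₁ : 0 < K₁) (hK₂ : 0 < K₂) (hL : 0 < L)
    (W : 𝒳 → 𝒴 × 𝒵₁ × 𝒵₂ → ℝ) (hW : IsChannel W) (pX : 𝒳 → ℝ) (hpX : IsPMF pX)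
    (δ : ℝ) (hδ : 0 < δ) (c₁ c₂ : ℝ) (hc₁ : 0 ≤ c₁) (hc₂ : 0 ≤ c₂)
    (h₁ : n * twJ pX (twV1 W) - Real.log (K₂ * L) ≤ c₁)
    (h₂ : n * twJ pX (twV2 W) - Real.log L ≤ c₂) (T : ℝ)
    (hT : twσ pX (twVY W) / (n * δ ^ 2)
        + ((K₁ : ℝ) * K₂ * L - 1) / Real.exp (n * (twJ pX (twVY W) - δ))
        + (n : ℝ)⁻¹ * (1 + n * δ + c₁ + twσ pX (twV1 W) / δ)
        + (n : ℝ)⁻¹ * (1 + n * δ + c₂ + twσ pX (twV2 W) / δ) ≤ T) :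
    ∃ enc : Fin K₁ × Fin K₂ → (Fin n → 𝒳) → ℝ, IsChannel enc ∧
      ∃ dec : (Fin n → 𝒴) → Fin K₁ × Fin K₂,
        errProb W enc dec ≤ T ∧
        leakMZ2 W enc * Real.log 2 ≤ n * T ∧
        leakM1Z1 W enc * Real.log 2 ≤ n * T := by
  have : Nonempty (Fin K₁) := ⟨⟨0, hK₁⟩⟩
  have : Nonempty (Fin K₂) := ⟨⟨0, hK₂⟩⟩
  have : Nonempty (Fin L) := ⟨⟨0, hL⟩⟩
  have hn' : (0 : ℝ) < n := by exact_mod_cast hn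
  have hK₁' : (0 : ℝ) < K₁ := by exact_mod_cast hK₁
  have hK₂' : (0 : ℝ) < K₂ := by exact_mod_cast hK₂
  have hL' : (0 : ℝ) < L := by exact_mod_cast hL
  have hP := twPn_pmf n hpX
  have hVY := twVn_channel n (twVY_ch hW)
  have hV1 := twVn_channel n (twV1_ch hW)
  have hV2 := twVn_channel n (twV2_ch hW)
  have hex : ∀ (C : (Fin K₁ × Fin K₂) × Fin L → (Fin n → 𝒳)) (b : Fin n → 𝒴),
      ∃ k, ∀ k', twVn n (twVY W) (C k') b ≤ twVn n (twVY W) (C k) b := fun C b =>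
    Finite.exists_max (fun k => twVn n (twVY W) (C k) b)
  choose D hD using hex
  let w : ((Fin K₁ × Fin K₂) × Fin L → (Fin n → 𝒳)) → ℝ := fun C => ∏ k, twPn n pX (C k)
  let Q1 : (Fin n → 𝒵₁) → ℝ := fun b => ∏ i, ∑ a, pX a * twV1 W a (b i)
  let Q2 : (Fin n → 𝒵₂) → ℝ := fun b => ∏ i, ∑ a, pX a * twV2 W a (b i)
  let U1 : ((Fin K₁ × Fin K₂) × Fin L → (Fin n → 𝒳)) → Fin K₁ → (Fin n → 𝒵₁) → ℝ :=
    fun C m b => ((K₂ : ℝ) * L)⁻¹ *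
      ∑ l : Fin K₂ × Fin L, twVn n (twV1 W) (C ((m, l.1), l.2)) b
  let U2 : ((Fin K₁ × Fin K₂) × Fin L → (Fin n → 𝒳)) → Fin K₁ × Fin K₂ → (Fin n → 𝒵₂) → ℝ :=
    fun C m b => (L : ℝ)⁻¹ * ∑ l : Fin L, twVn n (twV2 W) (C (m, l)) b
  let G0 : ((Fin K₁ × Fin K₂) × Fin L → (Fin n → 𝒳)) → ℝ := fun C =>
    ((K₁ : ℝ) * K₂ * L)⁻¹ * ∑ k, ∑ b, if D C b ≠ k then twVn n (twVY W) (C k) b else 0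
  let G1 : ((Fin K₁ × Fin K₂) × Fin L → (Fin n → 𝒳)) → Fin K₁ → ℝ := fun C m =>
    ∑ b, U1 C m b * Real.log (U1 C m b / Q1 b)
  let G2 : ((Fin K₁ × Fin K₂) × Fin L → (Fin n → 𝒳)) → Fin K₁ × Fin K₂ → ℝ := fun C m =>
    ∑ b, U2 C m b * Real.log (U2 C m b / Q2 b)
  have hQ1 : IsPMF Q1 := by
    have := tw_out_pmf hP hV1
    have e : Q1 = fun b => ∑ a, twPn n pX a * twVn n (twV1 W) a b := funext fun b => twQn n _ _ b
    rw [e]; exact this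
  have hQ2 : IsPMF Q2 := by
    have := tw_out_pmf hP hV2
    have e : Q2 = fun b => ∑ a, twPn n pX a * twVn n (twV2 W) a b := funext fun b => twQn n _ _ b
    rw [e]; exact this
  have hB0 : ∑ C, w C * G0 C ≤ twσ pX (twVY W) / (n * δ ^ 2)
        + ((K₁ : ℝ) * K₂ * L - 1) / Real.exp (n * (twJ pX (twVY W) - δ)) := by
    refine (tw_decode hP hVY _ (fun b => twQn n pX (twVY W) b) ((K₁ : ℝ) * K₂ * L) (by simp)
      (Real.exp (n * (twJ pX (twVY W) - δ))) (Real.exp_pos _) D hD).trans ?_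
    have := tw_atyp_n n hn hpX (twVY_ch hW) δ hδ
    linarith
  have hB1 : ∀ m, ∑ C, w C * G1 C m ≤ 1 + n * δ + c₁ + twσ pX (twV1 W) / δ := by
    intro m
    refine (tw_cover hP hV1 Q1 (fun b => twQn n pX (twV1 W) b)
      (fun l : Fin K₂ × Fin L => ((m, l.1), l.2)) (fun l l' h => by
        simp only [Prod.mk.injEq] at h
        exact Prod.ext h.1.2 h.2) ((K₂ : ℝ) * L) (by simp)).trans ?_
    exact tw_cover_n n hn hpX (twV1_ch hW) _ (by positivity) δ c₁ hδ hc₁ h₁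
  have hB2 : ∀ m, ∑ C, w C * G2 C m ≤ 1 + n * δ + c₂ + twσ pX (twV2 W) / δ := by
    intro m
    refine (tw_cover hP hV2 Q2 (fun b => twQn n pX (twV2 W) b)
      (fun l : Fin L => (m, l)) (fun l l' h => by
        simp only [Prod.mk.injEq] at h
        exact h.2) (L : ℝ) (by simp)).trans ?_
    exact tw_cover_n n hn hpX (twV2_ch hW) _ (by positivity) δ c₂ hδ hc₂ h₂
  have hA1 : ∑ C, w C * ((K₁ : ℝ)⁻¹ * ∑ m, G1 C m) ≤ 1 + n * δ + c₁ + twσ pX (twV1 W) / δ := by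
    have e : ∑ C, w C * ((K₁ : ℝ)⁻¹ * ∑ m, G1 C m) = (K₁ : ℝ)⁻¹ * ∑ m, ∑ C, w C * G1 C m := by
      rw [Finset.sum_comm, Finset.mul_sum]
      exact Finset.sum_congr rfl fun C _ => by rw [← Finset.mul_sum]; ring
    rw [e, inv_mul_le_iff₀ hK₁']
    refine (Finset.sum_le_sum fun m _ => hB1 m).trans (le_of_eq ?_)
    simp [mul_add]
  have hA2 : ∑ C, w C * (((K₁ : ℝ) * K₂)⁻¹ * ∑ m, G2 C m)
      ≤ 1 + n * δ + c₂ + twσ pX (twV2 W) / δ := by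
    have e : ∑ C, w C * (((K₁ : ℝ) * K₂)⁻¹ * ∑ m, G2 C m)
        = ((K₁ : ℝ) * K₂)⁻¹ * ∑ m, ∑ C, w C * G2 C m := by
      rw [Finset.sum_comm, Finset.mul_sum]
      exact Finset.sum_congr rfl fun C _ => by rw [← Finset.mul_sum]; ring
    rw [e, inv_mul_le_iff₀ (by positivity)]
    refine (Finset.sum_le_sum fun m _ => hB2 m).trans (le_of_eq ?_)
    simp [mul_add]
  obtain ⟨C, hwC, hC⟩ := tw_pick w (fun C => G0 C + (n : ℝ)⁻¹ * ((K₁ : ℝ)⁻¹ * ∑ m, G1 C m)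
      + (n : ℝ)⁻¹ * (((K₁ : ℝ) * K₂)⁻¹ * ∑ m, G2 C m))
    (fun C => Finset.prod_nonneg fun k _ => hP.1 _) (tw_E0 _ hP.2) T (by
      refine le_trans (le_of_eq ?_) (le_trans (add_le_add (add_le_add hB0
        (mul_le_mul_of_nonneg_left hA1 (inv_nonneg.2 hn'.le)))
        (mul_le_mul_of_nonneg_left hA2 (inv_nonneg.2 hn'.le))) hT)
      rw [Finset.mul_sum, Finset.mul_sum, ← Finset.sum_add_distrib, ← Finset.sum_add_distrib]
      exact Finset.sum_congr rfl fun C _ => by ring)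
  have hPC : ∀ k, twPn n pX (C k) ≠ 0 := fun k =>
    Finset.prod_ne_zero_iff.1 hwC k (Finset.mem_univ k)
  have hac1 : ∀ m b, Q1 b = 0 → U1 C m b = 0 := by
    intro m b hb
    have hb' : ∑ a, twPn n pX a * twVn n (twV1 W) a b = 0 := by rw [← twQn]; exact hb
    simp only [U1]
    rw [Finset.sum_eq_zero fun l _ =>
      (mul_eq_zero.1 (tw_zero hP hV1 hb' _)).resolve_left (hPC _), mul_zero]
  have hac2 : ∀ m b, Q2 b = 0 → U2 C m b = 0 := by
    intro m b hb
    have hb' : ∑ a, twPn n pX a * twVn n (twV2 W) a b = 0 := by rw [← twQn]; exact hb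
    simp only [U2]
    rw [Finset.sum_eq_zero fun l _ =>
      (mul_eq_zero.1 (tw_zero hP hV2 hb' _)).resolve_left (hPC _), mul_zero]
  have hU1 : IsChannel (U1 C) := fun m =>
    tw_avg_pmf hV1 (fun l : Fin K₂ × Fin L => C ((m, l.1), l.2)) _ (by simp)
  have hU2 : IsChannel (U2 C) := fun m =>
    tw_avg_pmf hV2 (fun l : Fin L => C (m, l)) _ (by simp)
  have hG1 : 0 ≤ (K₁ : ℝ)⁻¹ * ∑ m, G1 C m := mul_nonneg (by positivity)
    (Finset.sum_nonneg fun m _ => tw_kl_nonneg (hU1 m) hQ1 (hac1 m))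
  have hG2 : 0 ≤ ((K₁ : ℝ) * K₂)⁻¹ * ∑ m, G2 C m := mul_nonneg (by positivity)
    (Finset.sum_nonneg fun m _ => tw_kl_nonneg (hU2 m) hQ2 (hac2 m))
  have hG0 : 0 ≤ G0 C := mul_nonneg (by positivity)
    (Finset.sum_nonneg fun k _ => Finset.sum_nonneg fun b _ => by
      split_ifs
      · exact (hVY _).1 _
      · exact le_rfl)
  have hG1' := mul_nonneg (inv_nonneg.2 hn'.le) hG1
  have hG2' := mul_nonneg (inv_nonneg.2 hn'.le) hG2
  refine ⟨twEnc C, twEnc_ch hL C, fun ys => (D C ys).1, ?_, ?_, ?_⟩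
  · have := tw_errProb W hW C (D C)
    simp only [G0] at hC hG0
    linarith
  · have := tw_leak hU2 hQ2 hac2 _ ((K₁ : ℝ) * K₂) (by simp)
      (fun q => tw_joint2 W C q.1 q.2)
    refine le_trans this ?_
    have h : (n : ℝ)⁻¹ * (((K₁ : ℝ) * K₂)⁻¹ * ∑ m, G2 C m) ≤ T := by linarith
    rwa [inv_mul_le_iff₀ hn'] at h
  · have := tw_leak hU1 hQ1 hac1 _ (K₁ : ℝ) (by simp)
      (fun q => tw_joint1 W C q.1 q.2)
    refine le_trans this ?_
    have h : (n : ℝ)⁻¹ * ((K₁ : ℝ)⁻¹ * ∑ m, G1 C m) ≤ T := by linarith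
    rwa [inv_mul_le_iff₀ hn'] at h

theorem tw_floor (n : ℕ) (s : ℝ) (hs : 0 ≤ s) :
    ∃ K : ℕ, 0 < K ∧ (K : ℝ) ≤ Real.exp (n * s) ∧ n * s - 1 ≤ Real.log K := by
  have h1 : 1 ≤ Real.exp (n * s) := Real.one_le_exp (by positivity)
  have hK : 0 < ⌊Real.exp (n * s)⌋₊ := Nat.floor_pos.2 h1
  refine ⟨⌊Real.exp (n * s)⌋₊, hK, Nat.floor_le (Real.exp_pos _).le, ?_⟩
  have hK' : (1 : ℝ) ≤ ⌊Real.exp (n * s)⌋₊ := by exact_mod_cast hK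
  rw [Real.le_log_iff_exp_le (by linarith), Real.exp_sub]
  have h2 := Nat.lt_floor_add_one (Real.exp (n * s))
  have h3 : (2 : ℝ) ≤ Real.exp 1 := by
    have := Real.add_one_le_exp (1 : ℝ); linarith
  rw [div_le_iff₀ (Real.exp_pos _)]
  nlinarith

/-- for a discrete memoryless two-level security wiretap channel with
`X → Z₁ → Z₂`, any nonnegative pair with `R₁ ≤ I(X;Y) − I(X;Z₁)` and
`R₁ + R₂ ≤ I(X;Y) − I(X;Z₂)` for some input distribution is achievable. -/
theorem stmt0_nested_binning_inner_bound
    (W : 𝒳 → 𝒴 × 𝒵₁ × 𝒵₂ → ℝ) (hW : IsChannel W) (hdeg : DegradedZ1Z2 W)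
    (R₁ R₂ : ℝ) (hR₁ : 0 ≤ R₁) (hR₂ : 0 ≤ R₂)
    (pX : 𝒳 → ℝ) (hpX : IsPMF pX)
    (h₁ : R₁ ≤ mutInfo (jointXY pX W) - mutInfo (jointXZ1 pX W))
    (h₂ : R₁ + R₂ ≤ mutInfo (jointXY pX W) - mutInfo (jointXZ2 pX W)) :
    Achievable W R₁ R₂ := by
  intro ε hε
  have hlam : 0 < Real.log 2 := Real.log_pos one_lt_two
  have hlam1 : Real.log 2 ≤ 1 := by
    have := Real.log_le_sub_one_of_pos (x := 2) two_pos
    linarith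
  have eY := tw_mutInfo (P := pX) (twVY_ch hW) (jointXY pX W) (fun _ => rfl)
  have e1 := tw_mutInfo (P := pX) (twV1_ch hW) (jointXZ1 pX W) (fun _ => rfl)
  have e2 := tw_mutInfo (P := pX) (twV2_ch hW) (jointXZ2 pX W) (fun _ => rfl)
  have hJ2 := tw_J_nonneg hpX (twV2_ch hW)
  have hσ : ∀ {B : Type} [Fintype B] (V : 𝒳 → B → ℝ), IsChannel V → 0 ≤ twσ pX V :=
    fun V hV => Finset.sum_nonneg fun s _ =>
      mul_nonneg (mul_nonneg (hpX.1 _) ((hV _).1 _)) (sq_nonneg _)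
  have hσY := hσ _ (twVY_ch hW)
  have hσ1 := hσ _ (twV1_ch hW)
  have hσ2 := hσ _ (twV2_ch hW)
  have g1 := mul_le_mul_of_nonneg_right h₁ hlam.le
  have g2 := mul_le_mul_of_nonneg_right h₂ hlam.le
  rw [sub_mul, eY, e1] at g1
  rw [sub_mul, eY, e2, add_mul] at g2
  have hr1 : 0 ≤ R₁ * Real.log 2 := mul_nonneg hR₁ hlam.le
  have hr2 : 0 ≤ R₂ * Real.log 2 := mul_nonneg hR₂ hlam.le
  obtain ⟨r1, hr1e⟩ : ∃ r, r = R₁ * Real.log 2 := ⟨_, rfl⟩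
  obtain ⟨r2, hr2e⟩ : ∃ r, r = R₂ * Real.log 2 := ⟨_, rfl⟩
  rw [← hr1e] at g1 g2 hr1
  rw [← hr2e] at g2 hr2
  obtain ⟨δ, hδe⟩ : ∃ δ, δ = ε * Real.log 2 / 16 := ⟨_, rfl⟩
  have hδ : 0 < δ := by rw [hδe]; positivity
  set JY := twJ pX (twVY W)
  set J1 := twJ pX (twV1 W)
  set J2 := twJ pX (twV2 W)
  set σY := twσ pX (twVY W)
  set σ1 := twσ pX (twV1 W)
  set σ2 := twσ pX (twV2 W)
  obtain ⟨A, hA⟩ : ∃ A, A = σY / δ ^ 2 + 5 + σ1 / δ + σ2 / δ + 1 / δ := ⟨_, rfl⟩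
  have hA0 : 0 ≤ A := by rw [hA]; positivity
  obtain ⟨n, hn⟩ := exists_nat_ge (A / (8 * δ) + 1 / δ + 1)
  have hd0 : 0 ≤ A / (8 * δ) := by positivity
  have hd1 : 0 ≤ 1 / δ := by positivity
  have hn' : (0 : ℝ) < n := by linarith
  have hn0 : 0 < n := by exact_mod_cast hn'
  have hnδ : 1 ≤ n * δ := by
    have : 1 / δ ≤ n := by linarith
    rwa [div_le_iff₀ hδ] at this
  have hnA : A / n ≤ 8 * δ := by
    have : A / (8 * δ) ≤ n := by linarith
    rw [div_le_iff₀ (by positivity)] at this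
    rw [div_le_iff₀ hn']
    linarith
  obtain ⟨K₁, pK₁, uK₁, lK₁⟩ := tw_floor n (max (r1 - 2 * δ) 0) (le_max_right _ _)
  obtain ⟨K₂, pK₂, uK₂, lK₂⟩ := tw_floor n (max (r2 - 2 * δ) 0) (le_max_right _ _)
  obtain ⟨L, pL, uL, lL⟩ := tw_floor n (max (JY - r1 - r2 - 2 * δ) 0) (le_max_right _ _)
  have pK₁' : (0 : ℝ) < K₁ := by exact_mod_cast pK₁
  have pK₂' : (0 : ℝ) < K₂ := by exact_mod_cast pK₂
  have pL' : (0 : ℝ) < L := by exact_mod_cast pL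
  have b1 : n * (r1 - 2 * δ) - 1 ≤ Real.log K₁ :=
    le_trans (sub_le_sub_right (mul_le_mul_of_nonneg_left (le_max_left _ _) hn'.le) _) lK₁
  have b2 : n * (r2 - 2 * δ) - 1 ≤ Real.log K₂ :=
    le_trans (sub_le_sub_right (mul_le_mul_of_nonneg_left (le_max_left _ _) hn'.le) _) lK₂
  have bL : n * (JY - r1 - r2 - 2 * δ) - 1 ≤ Real.log L :=
    le_trans (sub_le_sub_right (mul_le_mul_of_nonneg_left (le_max_left _ _) hn'.le) _) lL
  have hN : (K₁ : ℝ) * K₂ * L - 1 ≤ Real.exp (n * (JY - 2 * δ)) := by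
    have hprod : (K₁ : ℝ) * K₂ * L ≤ Real.exp (n * (max (r1 - 2 * δ) 0 + max (r2 - 2 * δ) 0
        + max (JY - r1 - r2 - 2 * δ) 0)) := by
      rw [mul_add, mul_add, Real.exp_add, Real.exp_add]
      gcongr
    by_cases hcase : max (r1 - 2 * δ) 0 + max (r2 - 2 * δ) 0
        + max (JY - r1 - r2 - 2 * δ) 0 ≤ JY - 2 * δ
    · have := Real.exp_le_exp.2 (mul_le_mul_of_nonneg_left hcase hn'.le)
      linarith
    · have hz : max (r1 - 2 * δ) 0 + max (r2 - 2 * δ) 0 + max (JY - r1 - r2 - 2 * δ) 0 = 0 := by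
        rcases max_cases (r1 - 2 * δ) 0 with ⟨h, h'⟩ | ⟨h, h'⟩ <;>
        rcases max_cases (r2 - 2 * δ) 0 with ⟨k, k'⟩ | ⟨k, k'⟩ <;>
        rcases max_cases (JY - r1 - r2 - 2 * δ) 0 with ⟨j, j'⟩ | ⟨j, j'⟩ <;>
        rw [h, k, j] at hcase ⊢ <;> first | (exfalso; apply hcase; linarith) | norm_num
      rw [hz, mul_zero, Real.exp_zero] at hprod
      have := Real.exp_pos (n * (JY - 2 * δ))
      linarith
  have hratio : ((K₁ : ℝ) * K₂ * L - 1) / Real.exp (n * (JY - δ)) ≤ (1 / δ) / n := by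
    rw [div_le_iff₀ (Real.exp_pos _)]
    have hx : Real.exp (n * (JY - 2 * δ)) = Real.exp (-(n * δ)) * Real.exp (n * (JY - δ)) := by
      rw [← Real.exp_add]; congr 1; ring
    have hy : Real.exp (-(n * δ)) ≤ 1 / δ / n := by
      rw [Real.exp_neg, div_div, one_div, mul_comm δ]
      apply inv_anti₀ (by positivity)
      have := Real.add_one_le_exp (n * δ)
      linarith
    have := mul_le_mul_of_nonneg_right hy (Real.exp_pos (n * (JY - δ))).le
    linarith
  have hη : 16 * δ = ε * Real.log 2 := by rw [hδe]; ring
  have hT : σY / (n * δ ^ 2) + ((K₁ : ℝ) * K₂ * L - 1) / Real.exp (n * (JY - δ))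
      + (n : ℝ)⁻¹ * (1 + n * δ + (4 * (n * δ) + 2) + σ1 / δ)
      + (n : ℝ)⁻¹ * (1 + n * δ + (2 * (n * δ) + 1) + σ2 / δ) ≤ ε * Real.log 2 := by
    rw [← hη]
    have : σY / (n * δ ^ 2) + (1 / δ) / n
      + (n : ℝ)⁻¹ * (1 + n * δ + (4 * (n * δ) + 2) + σ1 / δ)
      + (n : ℝ)⁻¹ * (1 + n * δ + (2 * (n * δ) + 1) + σ2 / δ) = 8 * δ + A / n := by
      rw [hA]; field_simp; ring
    linarith
  obtain ⟨enc, henc, dec, q1, q2, q3⟩ := tw_code hn0 pK₁ pK₂ pL W hW pX hpX δ hδ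
    (4 * (n * δ) + 2) (2 * (n * δ) + 1) (by positivity) (by positivity)
    (by
      rw [Real.log_mul pK₂'.ne' pL'.ne']
      have := mul_le_mul_of_nonneg_left (show J1 ≤ JY - r1 by linarith) hn'.le
      linarith)
    (by
      have := mul_le_mul_of_nonneg_left (show J2 ≤ JY - r1 - r2 by linarith) hn'.le
      linarith)
    (ε * Real.log 2) hT
  refine ⟨n, hn0, K₁, K₂, pK₁, pK₂, ?_, ?_, enc, henc, dec, ?_, ?_, ?_⟩
  · rw [Real.logb, le_div_iff₀ hlam]
    have : n * (R₁ - ε) * Real.log 2 = n * (r1 - 16 * δ) := by rw [hη, hr1e]; ring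
    rw [this]
    linarith
  · rw [Real.logb, le_div_iff₀ hlam]
    have : n * (R₂ - ε) * Real.log 2 = n * (r2 - 16 * δ) := by rw [hη, hr2e]; ring
    rw [this]
    linarith
  · exact q1.trans (mul_le_of_le_one_right hε.le hlam1)
  · rw [← mul_assoc] at q2
    exact le_of_mul_le_mul_right q2 hlam
  · rw [← mul_assoc] at q3
    exact le_of_mul_le_mul_right q3 hlam
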